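/- For all real numbers x, y with 0 < x < 1 and 0 < y < 1, one has Li_{1,1}(x,y) = \int_0^y ( -log(1-xt)/(1-t) ) dt. -/

import Mathlib

/-- The pairs `0 < m < n` are parametrised by `m = i + 1`, `n = i + j + 2`. -/
def posLtPairEquiv : ℕ × ℕ ≃ {p : ℕ × ℕ // 0 < p.1 ∧ p.1 < p.2} where
  toFun q := ⟨(q.1 + 1, q.1 + q.2 + 2), by dsimp only; omega⟩
  invFun p := (p.1.1 - 1, p.1.2 - p.1.1 - 1)
  left_inv q := by ext <;> dsimp only <;> omega
  right_inv p := by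
    obtain ⟨⟨m, n⟩, h⟩ := p
    dsimp only at h
    ext <;> dsimp only <;> omega

lemma hasSum_neg_log_div_one_sub {x t : ℝ} (hx0 : 0 ≤ x) (hx : x < 1) (ht0 : 0 ≤ t)
    (ht : t < 1) :
    HasSum (fun q : ℕ × ℕ => x ^ (q.1 + 1) / ((q.1 : ℝ) + 1) * t ^ (q.1 + q.2 + 1))
      (-Real.log (1 - x * t) / (1 - t)) := by
  have hxt0 : 0 ≤ x * t := mul_nonneg hx0 ht0
  have hxt : |x * t| < 1 := by
    rw [abs_of_nonneg hxt0]
    nlinarith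
  have hlog := Real.hasSum_pow_div_log_of_abs_lt_one hxt
  have hgeom := hasSum_geometric_of_lt_one ht0 ht
  have hsum := hlog.mul hgeom (hlog.summable.mul_of_nonneg hgeom.summable
    (fun _ => by positivity) (fun _ => by positivity))
  convert! hsum using 1
  funext q
  rw [mul_pow]
  ring

theorem double_log_eq_integral (x y : ℝ)
    (hx0 : 0 < x) (hx : x < 1) (hy0 : 0 < y) (hy : y < 1) :
    ∑' p : {p : ℕ × ℕ // 0 < p.1 ∧ p.1 < p.2},
        (x ^ p.1.1 / (p.1.1 : ℝ)) * (y ^ p.1.2 / (p.1.2 : ℝ)) =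
      ∫ t in (0:ℝ)..y, -Real.log (1 - x * t) / (1 - t) := by
  have hgeom := summable_geometric_of_lt_one hy0.le hy
  have hbound : Summable fun q : ℕ × ℕ => y ^ q.1 * y ^ q.2 :=
    hgeom.mul_of_nonneg hgeom (fun _ => by positivity) (fun _ => by positivity)
  have hint := intervalIntegral.hasSum_integral_of_dominated_convergence
    (μ := MeasureTheory.volume) (a := 0) (b := y)
    (F := fun (q : ℕ × ℕ) t => x ^ (q.1 + 1) / ((q.1 : ℝ) + 1) * t ^ (q.1 + q.2 + 1))
    (f := fun t => -Real.log (1 - x * t) / (1 - t))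
    (fun q _ => y ^ q.1 * y ^ q.2)
    (fun q => by
      apply Continuous.aestronglyMeasurable
      fun_prop)
    (fun q => by
      refine .of_forall fun t ht => ?_
      rw [Set.uIoc_of_le hy0.le] at ht
      have ht0 : 0 ≤ t := ht.1.le
      rw [Real.norm_of_nonneg (by positivity), ← pow_add]
      have hcoeff : x ^ (q.1 + 1) / ((q.1 : ℝ) + 1) ≤ 1 :=
        div_le_one_of_le₀ ((pow_le_one₀ hx0.le hx.le).trans (by simp)) (by positivity)
      calc x ^ (q.1 + 1) / ((q.1 : ℝ) + 1) * t ^ (q.1 + q.2 + 1)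
          ≤ t ^ (q.1 + q.2 + 1) := mul_le_of_le_one_left (by positivity) hcoeff
        _ ≤ y ^ (q.1 + q.2 + 1) := pow_le_pow_left₀ ht0 ht.2 _
        _ ≤ y ^ (q.1 + q.2) := pow_le_pow_of_le_one hy0.le hy.le (Nat.le_succ _))
    (.of_forall fun _ _ => hbound)
    intervalIntegrable_const
    (by
      refine .of_forall fun t ht => ?_
      rw [Set.uIoc_of_le hy0.le] at ht
      exact hasSum_neg_log_div_one_sub hx0.le hx ht.1.le (ht.2.trans_lt hy))
  rw [← hint.tsum_eq, ← posLtPairEquiv.tsum_eq]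
  refine tsum_congr fun q => ?_
  rw [intervalIntegral.integral_const_mul, integral_pow]
  simp only [posLtPairEquiv, Equiv.coe_fn_mk]
  push_cast
  rw [zero_pow (by omega)]
  ring
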